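/- Let ct(I) = (V, ≺, L) be the computation tree generated by a run of Prove_C on input nested sequent I. For every nested sequent G occurring in ct(I) and every formula B occurring in a component of G at tree-depth k, the modal depth of B is at most md(I) − k, where md(I) is the modal depth of I. -/

import Mathlib

/-! # Core definitions: intuitionistic tense logic, bi-relational semantics,
nested sequents (seq-trees), the calculus NIK_tC, proof search, computation
trees, morphisms and blueprints. -/

/-- Formulae of the tense language `𝓛`:
`A ::= p | ⊥ | A ∨ A | A ∧ A | A ⊃ A | ◇A | ◆A | □A | ■A`. -/
inductive Fml : Type where
  | atom : ℕ → Fml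
  | bot  : Fml
  | or   : Fml → Fml → Fml
  | and  : Fml → Fml → Fml
  | imp  : Fml → Fml → Fml
  | dia  : Fml → Fml   -- ◇ (forward diamond)
  | bdia : Fml → Fml   -- ◆ (backward diamond)
  | box  : Fml → Fml   -- □ (forward box)
  | bbox : Fml → Fml   -- ■ (backward box)
  deriving DecidableEq

namespace Fml

/-- Modal depth of a formula. -/
def mdep : Fml → ℕ
  | atom _ => 0
  | bot => 0
  | or A B => max A.mdep B.mdep
  | and A B => max A.mdep B.mdep
  | imp A B => max A.mdep B.mdep
  | dia A => A.mdep + 1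
  | bdia A => A.mdep + 1
  | box A => A.mdep + 1
  | bbox A => A.mdep + 1

/-- The set of subformulae of a formula. -/
def subf : Fml → Finset Fml
  | atom p => {atom p}
  | bot => {bot}
  | or A B => insert (or A B) (A.subf ∪ B.subf)
  | and A B => insert (and A B) (A.subf ∪ B.subf)
  | imp A B => insert (imp A B) (A.subf ∪ B.subf)
  | dia A => insert (dia A) A.subf
  | bdia A => insert (bdia A) A.subf
  | box A => insert (box A) A.subf
  | bbox A => insert (bbox A) A.subf

/-- `⟨x⟩`: the diamond determined by the direction `x` (`true` = forward `◇`,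
`false` = backward `◆`). -/
def diaF : Bool → Fml → Fml
  | true, A => dia A
  | false, A => bdia A

/-- `[x]`: the box determined by the direction `x` (`true` = forward `□`,
`false` = backward `■`). -/
def boxF : Bool → Fml → Fml
  | true, A => box A
  | false, A => bbox A

end Fml

/-- A bi-relational model `M = (W, ≤, R, V)`: `≤` is a pre-order, `R` satisfies
the confluence conditions (F1) and (F2), and `V` is monotone along `≤`. -/
structure Model where
  W : Type
  le : W → W → Prop
  R : W → W → Prop
  val : W → ℕ → Prop
  nonempty : Nonempty W
  le_refl : ∀ w, le w w
  le_trans : ∀ {w u v}, le w u → le u v → le w v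
  F1 : ∀ {w w' v}, le w w' → R w v → ∃ v', R w' v' ∧ le v v'
  F2 : ∀ {w v v'}, R w v → le v v' → ∃ w', le w w' ∧ R w' v'
  mono : ∀ {w u p}, le w u → val w p → val u p

/-- The satisfaction relation `M, w ⊨ A`. -/
def Model.Sat (M : Model) : M.W → Fml → Prop
  | w, .atom p => M.val w p
  | _, .bot => False
  | w, .or A B => M.Sat w A ∨ M.Sat w B
  | w, .and A B => M.Sat w A ∧ M.Sat w B
  | w, .imp A B => ∀ u, M.le w u → M.Sat u A → M.Sat u B
  | w, .dia A => ∃ u, M.R w u ∧ M.Sat u A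
  | w, .bdia A => ∃ u, M.R u w ∧ M.Sat u A
  | w, .box A => ∀ u v, M.le w u → M.R u v → M.Sat v A
  | w, .bbox A => ∀ u v, M.le w u → M.R v u → M.Sat v A

/-- `M` is based on a frame in the class `F_C`, where the subset
`C ⊆ {T, B, D}` is encoded by the three Boolean flags `ct`, `cb`, `cd`:
`R` is reflexive if `T ∈ C`, symmetric if `B ∈ C`, and serial if `D ∈ C`. -/
def Model.InClass (M : Model) (ct cb cd : Bool) : Prop :=
  (ct = true → ∀ w, M.R w w) ∧
  (cb = true → ∀ w u, M.R w u → M.R u w) ∧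
  (cd = true → ∀ w, ∃ u, M.R w u)

/-- A Gentzen sequent `Γ ⊢ Δ` (finite sets of formulae). -/
abbrev GSeq : Type := Finset Fml × Finset Fml

/-- A seq-tree (equivalently, a nested sequent): a finite rooted tree whose
vertices (names, drawn from `ℕ`) are labelled with Gentzen sequents and whose
edges are labelled with a direction (`true` = forward `•`, `false` =
backward `◦`). -/
structure SeqTree where
  verts : Finset ℕ
  root : ℕ
  edges : Finset (ℕ × ℕ)
  elabel : ℕ → ℕ → Bool
  vlab : ℕ → GSeq
  root_mem : root ∈ verts
  edges_sub : ∀ e ∈ edges, e.1 ∈ verts ∧ e.2 ∈ verts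
  root_no_parent : ∀ u, (u, root) ∉ edges
  parent_unique : ∀ v ∈ verts, ∀ u u', (u, v) ∈ edges → (u', v) ∈ edges → u = u'
  connected : ∀ v ∈ verts, Relation.ReflTransGen (fun a b => (a, b) ∈ edges) root v

namespace SeqTree

/-- The antecedent (input formulae) of the `w`-component. -/
def ant (T : SeqTree) (w : ℕ) : Finset Fml := (T.vlab w).1

/-- The consequent (output formulae) of the `w`-component. -/
def suc (T : SeqTree) (w : ℕ) : Finset Fml := (T.vlab w).2

/-- `T.AtDepth w k`: the component `w` occurs at depth `k` in `T`. -/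
inductive AtDepth (T : SeqTree) : ℕ → ℕ → Prop where
  | root : T.AtDepth T.root 0
  | step {u v k} : T.AtDepth u k → (u, v) ∈ T.edges → T.AtDepth v (k + 1)

/-- `w` is a leaf of the seq-tree `T`. -/
def IsLeaf (T : SeqTree) (w : ℕ) : Prop := w ∈ T.verts ∧ ∀ u, (w, u) ∉ T.edges

/-- The modal depth of a nested sequent: the maximum over components `w` at
depth `k` of `(modal depth of a formula at w) + k`. -/
noncomputable def mdep (T : SeqTree) : ℕ :=
  sSup {n | ∃ w ∈ T.verts, ∃ k, T.AtDepth w k ∧ ∃ A ∈ T.ant w ∪ T.suc w, n = A.mdep + k}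

/-- `T ⊨ w ↠ₓ^C u`: the C-closure reachability relation of Definition 3.3,
with `C ⊆ {T,B}` encoded by the flags `ct`, `cb`. -/
def Reach (T : SeqTree) (ct cb : Bool) (x : Bool) (w u : ℕ) : Prop :=
  ((w, u) ∈ T.edges ∧ T.elabel w u = x) ∨
  ((u, w) ∈ T.edges ∧ T.elabel u w = !x) ∨
  (ct = true ∧ w = u ∧ w ∈ T.verts) ∨
  (cb = true ∧ (((w, u) ∈ T.edges ∧ T.elabel w u = !x) ∨
                ((u, w) ∈ T.edges ∧ T.elabel u w = x)))

/-- All formulae occurring in `T`, together with their subformulae. -/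
def subfs (T : SeqTree) : Finset Fml :=
  (T.verts.biUnion fun w => T.ant w ∪ T.suc w).biUnion Fml.subf

end SeqTree

/-- `M, ι ⊨ T`: satisfaction of a seq-tree on a model under an
`M`-interpretation `ι` (Definition 3.2): if every `•`-edge `(u,v)` satisfies
`ι(u) R ι(v)` and every `◦`-edge `(u,v)` satisfies `ι(v) R ι(u)`, then some
component `v` satisfies `M, ι(v) ⊨ ⋀Γ ⊃ ⋁Δ`. -/
def Model.SatSeq (M : Model) (T : SeqTree) (ι : ℕ → M.W) : Prop :=
  (∀ e ∈ T.edges, (T.elabel e.1 e.2 = true → M.R (ι e.1) (ι e.2)) ∧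
                  (T.elabel e.1 e.2 = false → M.R (ι e.2) (ι e.1))) →
  ∃ v ∈ T.verts, ∀ u, M.le (ι v) u →
    (∀ A ∈ T.ant v, M.Sat u A) → ∃ B ∈ T.suc v, M.Sat u B

/-- A default (trivial) seq-tree. -/
def SeqTree.triv : SeqTree where
  verts := {0}
  root := 0
  edges := ∅
  elabel := fun _ _ => true
  vlab := fun _ => (∅, ∅)
  root_mem := Finset.mem_singleton_self 0
  edges_sub := by intro e he; simp at he
  root_no_parent := by intro u h; simp at h
  parent_unique := by intro v _ u u' h; simp at h
  connected := by
    intro v hv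
    have hv0 : v = 0 := Finset.mem_singleton.mp hv
    subst hv0
    exact Relation.ReflTransGen.refl

instance : Inhabited SeqTree := ⟨SeqTree.triv⟩

/-- The nested sequent `⊢ A` consisting of a single component with empty
antecedent and consequent `{A}`. -/
def singleSeq (A : Fml) : SeqTree where
  verts := {0}
  root := 0
  edges := ∅
  elabel := fun _ _ => true
  vlab := fun _ => (∅, {A})
  root_mem := Finset.mem_singleton_self 0
  edges_sub := by intro e he; simp at he
  root_no_parent := by intro u h; simp at h
  parent_unique := by intro v _ u u' h; simp at h
  connected := by
    intro v hv
    have hv0 : v = 0 := Finset.mem_singleton.mp hv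
    subst hv0
    exact Relation.ReflTransGen.refl

/-! ## Morphisms between seq-trees -/

/-- A weak morphism between seq-trees: a root-preserving vertex map that
preserves edges and edge labels. -/
def WeakMorphism (T T' : SeqTree) (f : ℕ → ℕ) : Prop :=
  (∀ v ∈ T.verts, f v ∈ T'.verts) ∧
  f T.root = T'.root ∧
  ∀ u v, (u, v) ∈ T.edges → (f u, f v) ∈ T'.edges ∧ T.elabel u v = T'.elabel (f u) (f v)

/-- A strong morphism: a weak morphism additionally preserving vertex labels. -/
def StrongMorphism (T T' : SeqTree) (f : ℕ → ℕ) : Prop :=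
  WeakMorphism T T' f ∧ ∀ v ∈ T.verts, T.vlab v = T'.vlab (f v)

/-- Morphic equivalence `T ≃ T'`: strong morphisms exist in both directions. -/
def MorphEquiv (T T' : SeqTree) : Prop :=
  (∃ f, StrongMorphism T T' f) ∧ (∃ g, StrongMorphism T' T g)

/-- `T ∈ S(I)`: all vertex labels of `T` are built from subformulae of `I`. -/
def InS (I T : SeqTree) : Prop := ∀ w ∈ T.verts, T.ant w ∪ T.suc w ⊆ I.subfs

/-- `T` has depth at most `k`. -/
def DepthLE (T : SeqTree) (k : ℕ) : Prop := ∀ v n, T.AtDepth v n → n ≤ k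

/-! ## The rules of the calculus `NIK_tC` -/

/-- Two seq-trees share the same underlying shape (vertices, root, edges,
edge labels). -/
def sameShape (T T' : SeqTree) : Prop :=
  T'.verts = T.verts ∧ T'.root = T.root ∧ T'.edges = T.edges ∧ T'.elabel = T.elabel

/-- `T'` is `T` with the label of the component `w` replaced by `s`. -/
def updAt (T : SeqTree) (w : ℕ) (s : GSeq) (T' : SeqTree) : Prop :=
  sameShape T T' ∧ T'.vlab = Function.update T.vlab w s

/-- `T'` is `T` extended with a fresh child `u` of `w`, over an edge labelled
`x`, with component label `s`. -/
def extendAt (T : SeqTree) (w u : ℕ) (x : Bool) (s : GSeq) (T' : SeqTree) : Prop :=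
  w ∈ T.verts ∧ u ∉ T.verts ∧
  T'.verts = insert u T.verts ∧ T'.root = T.root ∧
  T'.edges = insert (w, u) T.edges ∧
  T'.elabel = (fun a b => if a = w ∧ b = u then x else T.elabel a b) ∧
  T'.vlab = Function.update T.vlab u s

/-- The rule `∨L` (conclusion `T`, premises `T1`, `T2`). -/
def OrLRule (T : SeqTree) (w : ℕ) (A B : Fml) (T1 T2 : SeqTree) : Prop :=
  ∃ Γ, w ∈ T.verts ∧ T.ant w = insert (A.or B) Γ ∧
    updAt T w (insert A Γ, T.suc w) T1 ∧ updAt T w (insert B Γ, T.suc w) T2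

/-- The rule `∨R`. -/
def OrRRule (T : SeqTree) (w : ℕ) (A B : Fml) (T' : SeqTree) : Prop :=
  ∃ Δ, w ∈ T.verts ∧ T.suc w = insert (A.or B) Δ ∧
    updAt T w (T.ant w, insert A (insert B Δ)) T'

/-- The rule `∧L`. -/
def AndLRule (T : SeqTree) (w : ℕ) (A B : Fml) (T' : SeqTree) : Prop :=
  ∃ Γ, w ∈ T.verts ∧ T.ant w = insert (A.and B) Γ ∧
    updAt T w (insert A (insert B Γ), T.suc w) T'

/-- The rule `∧R`. -/
def AndRRule (T : SeqTree) (w : ℕ) (A B : Fml) (T1 T2 : SeqTree) : Prop :=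
  ∃ Δ, w ∈ T.verts ∧ T.suc w = insert (A.and B) Δ ∧
    updAt T w (T.ant w, insert A Δ) T1 ∧ updAt T w (T.ant w, insert B Δ) T2

/-- The rule `⊃L`. -/
def ImpLRule (T : SeqTree) (w : ℕ) (A B : Fml) (T1 T2 : SeqTree) : Prop :=
  ∃ Γ, w ∈ T.verts ∧ T.ant w = insert (A.imp B) Γ ∧
    updAt T w (T.ant w, insert A (T.suc w)) T1 ∧ updAt T w (insert B Γ, T.suc w) T2

/-- The (non-invertible) rule `⊃R`: all consequents of all other components are
deleted, and `A ⊢ B` is adjoined at `w`. -/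
def ImpRRule (T : SeqTree) (w : ℕ) (A B : Fml) (T' : SeqTree) : Prop :=
  w ∈ T.verts ∧ A.imp B ∈ T.suc w ∧ sameShape T T' ∧
  (∀ v, v ≠ w → T'.vlab v = (T.ant v, ∅)) ∧
  T'.vlab w = (insert A (T.ant w), {B})

/-- The rule `⟨x⟩L`: a fresh `x`-child containing `A` in its antecedent is
created. -/
def DiaLRule (T : SeqTree) (w u : ℕ) (x : Bool) (A : Fml) (T' : SeqTree) : Prop :=
  ∃ Γ, w ∈ T.verts ∧ u ∉ T.verts ∧ T.ant w = insert (Fml.diaF x A) Γ ∧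
    T'.verts = insert u T.verts ∧ T'.root = T.root ∧
    T'.edges = insert (w, u) T.edges ∧
    T'.elabel = (fun a b => if a = w ∧ b = u then x else T.elabel a b) ∧
    T'.vlab = fun v => if v = u then ({A}, ∅) else if v = w then (Γ, T.suc w) else T.vlab v

/-- The propagation rule `⟨x⟩R`, restricted by the C-closure reachability
relation `w ↠ₓ^C u`. -/
def DiaRRule (ct cb : Bool) (T : SeqTree) (w u : ℕ) (x : Bool) (A : Fml) (T' : SeqTree) : Prop :=
  w ∈ T.verts ∧ u ∈ T.verts ∧ Fml.diaF x A ∈ T.suc w ∧ T.Reach ct cb x w u ∧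
  updAt T u (T.ant u, insert A (T.suc u)) T'

/-- The propagation rule `[x]L`, restricted by `w ↠ₓ^C u`. -/
def BoxLRule (ct cb : Bool) (T : SeqTree) (w u : ℕ) (x : Bool) (A : Fml) (T' : SeqTree) : Prop :=
  w ∈ T.verts ∧ u ∈ T.verts ∧ Fml.boxF x A ∈ T.ant w ∧ T.Reach ct cb x w u ∧
  updAt T u (insert A (T.ant u), T.suc u) T'

/-- The (non-invertible) rule `[x]R`: all consequents are deleted and a fresh
`x`-child `⊢ A` is created. -/
def BoxRRule (T : SeqTree) (w u : ℕ) (x : Bool) (A : Fml) (T' : SeqTree) : Prop :=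
  w ∈ T.verts ∧ u ∉ T.verts ∧ Fml.boxF x A ∈ T.suc w ∧
  T'.verts = insert u T.verts ∧ T'.root = T.root ∧
  T'.edges = insert (w, u) T.edges ∧
  T'.elabel = (fun a b => if a = w ∧ b = u then x else T.elabel a b) ∧
  (∀ v ∈ T.verts, T'.vlab v = (T.ant v, ∅)) ∧
  T'.vlab u = (∅, {A})

/-- The rule `d`: an empty fresh `•`-child is adjoined. -/
def DRule (T : SeqTree) (w u : ℕ) (T' : SeqTree) : Prop :=
  extendAt T w u true (∅, ∅) T'

/-- Provability in the nested sequent calculus `NIK_tC`, where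
`C ⊆ {T, B, D}` is encoded by the Boolean flags `ct`, `cb`, `cd`
(the rule `d` belongs to the calculus iff `D ∈ C`). -/
inductive Prov (ct cb cd : Bool) : SeqTree → Prop where
  | id {T : SeqTree} {w p} : w ∈ T.verts → Fml.atom p ∈ T.ant w → Fml.atom p ∈ T.suc w →
      Prov ct cb cd T
  | botL {T : SeqTree} {w} : w ∈ T.verts → Fml.bot ∈ T.ant w → Prov ct cb cd T
  | orL {T w A B T1 T2} : OrLRule T w A B T1 T2 → Prov ct cb cd T1 → Prov ct cb cd T2 →
      Prov ct cb cd T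
  | orR {T w A B T'} : OrRRule T w A B T' → Prov ct cb cd T' → Prov ct cb cd T
  | andL {T w A B T'} : AndLRule T w A B T' → Prov ct cb cd T' → Prov ct cb cd T
  | andR {T w A B T1 T2} : AndRRule T w A B T1 T2 → Prov ct cb cd T1 → Prov ct cb cd T2 →
      Prov ct cb cd T
  | impL {T w A B T1 T2} : ImpLRule T w A B T1 T2 → Prov ct cb cd T1 → Prov ct cb cd T2 →
      Prov ct cb cd T
  | impR {T w A B T'} : ImpRRule T w A B T' → Prov ct cb cd T' → Prov ct cb cd T
  | diaL {T w u x A T'} : DiaLRule T w u x A T' → Prov ct cb cd T' → Prov ct cb cd T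
  | diaR {T w u x A T'} : DiaRRule ct cb T w u x A T' → Prov ct cb cd T' → Prov ct cb cd T
  | boxL {T w u x A T'} : BoxLRule ct cb T w u x A T' → Prov ct cb cd T' → Prov ct cb cd T
  | boxR {T w u x A T'} : BoxRRule T w u x A T' → Prov ct cb cd T' → Prov ct cb cd T
  | d {T w u T'} : cd = true → DRule T w u T' → Prov ct cb cd T' → Prov ct cb cd T

/-! ## Saturation, stability, initial sequents -/

/-- An initial sequent: some formula occurs among the input and output
formulae, or `⊥` occurs among the input formulae (lines 1–3 of `Prove_C`). -/
def InitialSeq (T : SeqTree) : Prop :=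
  (∃ A : Fml, (∃ w ∈ T.verts, A ∈ T.ant w) ∧ (∃ u ∈ T.verts, A ∈ T.suc u)) ∨
  (∃ w ∈ T.verts, Fml.bot ∈ T.ant w)

/-- `C`-saturation of a seq-tree (Definition 4.2); `m` is the modal depth of
the input sequent `I` of the proof search (used by condition `(d)`). -/
def Saturated (ct cb cd : Bool) (m : ℕ) (T : SeqTree) : Prop :=
  ∀ w ∈ T.verts,
    (∀ A : Fml, ¬ (A ∈ T.ant w ∧ A ∈ T.suc w)) ∧
    Fml.bot ∉ T.ant w ∧
    (∀ A B, A.or B ∈ T.ant w → A ∈ T.ant w ∨ B ∈ T.ant w) ∧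
    (∀ A B, A.or B ∈ T.suc w → A ∈ T.suc w ∧ B ∈ T.suc w) ∧
    (∀ A B, A.and B ∈ T.ant w → A ∈ T.ant w ∧ B ∈ T.ant w) ∧
    (∀ A B, A.and B ∈ T.suc w → A ∈ T.suc w ∨ B ∈ T.suc w) ∧
    (∀ A B, A.imp B ∈ T.ant w → A ∈ T.suc w ∨ B ∈ T.ant w) ∧
    (∀ x A, Fml.diaF x A ∈ T.ant w →
      ∃ u, (w, u) ∈ T.edges ∧ T.elabel w u = x ∧ A ∈ T.ant u) ∧
    (∀ x A u, Fml.diaF x A ∈ T.suc w → T.Reach ct cb x w u → A ∈ T.suc u) ∧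
    (∀ x A u, Fml.boxF x A ∈ T.ant w → T.Reach ct cb x w u → A ∈ T.ant u) ∧
    (cd = true → ∀ k, T.AtDepth w k → k ≤ m →
      ∃ u, (w, u) ∈ T.edges ∧ T.elabel w u = true)

/-- A stable seq-tree: saturated, with no output implications or boxes. -/
def StableSeq (ct cb cd : Bool) (m : ℕ) (T : SeqTree) : Prop :=
  Saturated ct cb cd m T ∧
  ∀ w ∈ T.verts, (∀ A B : Fml, A.imp B ∉ T.suc w) ∧
    (∀ A : Fml, Fml.box A ∉ T.suc w) ∧ (∀ A : Fml, Fml.bbox A ∉ T.suc w)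

/-- `T` is a repeat relative to the list `hist` of its ancestors: it is
saturated and admits a strong morphism to some ancestor (its companion). -/
def Repeats (ct cb cd : Bool) (m : ℕ) (hist : List SeqTree) (T : SeqTree) : Prop :=
  Saturated ct cb cd m T ∧ ∃ H ∈ hist, ∃ f, StrongMorphism T H f

/-- Proof search halts at `T` (relative to the ancestors `hist`): `T` is
initial, stable, or a repeat. -/
def Halted (ct cb cd : Bool) (m : ℕ) (hist : List SeqTree) (T : SeqTree) : Prop :=
  InitialSeq T ∨ StableSeq ct cb cd m T ∨ Repeats ct cb cd m hist T

/-! ## The proof-search steps of `Prove_C` -/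

/-- Adjoin `A` to the antecedent of the `w`-component (the operation
`G ◁_w (A ⊢)`). -/
def addAnt (T : SeqTree) (w : ℕ) (A : Fml) (T' : SeqTree) : Prop :=
  w ∈ T.verts ∧ updAt T w (insert A (T.ant w), T.suc w) T'

/-- Adjoin `A` to the consequent of the `w`-component (the operation
`G ◁_w (⊢ A)`). -/
def addSuc (T : SeqTree) (w : ℕ) (A : Fml) (T' : SeqTree) : Prop :=
  w ∈ T.verts ∧ updAt T w (T.ant w, insert A (T.suc w)) T'

/-- One (bottom-up, non-redundant) rule application performed by the
proof-search algorithm `Prove_C` on input of modal depth `m`, producing the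
premise `T'` from `T`.  The disjunctive-branching rule `db` (simultaneous
`⊃R`/`[x]R` applications) is applied only to saturated sequents. -/
def AlgStep (ct cb cd : Bool) (m : ℕ) (T T' : SeqTree) : Prop :=
  -- ∨L
  (∃ w A B, w ∈ T.verts ∧ Fml.or A B ∈ T.ant w ∧ A ∉ T.ant w ∧ B ∉ T.ant w ∧
    (addAnt T w A T' ∨ addAnt T w B T')) ∨
  -- ∨R
  (∃ w A B, w ∈ T.verts ∧ Fml.or A B ∈ T.suc w ∧ ¬ (A ∈ T.suc w ∧ B ∈ T.suc w) ∧
    updAt T w (T.ant w, insert A (insert B (T.suc w))) T') ∨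
  -- ∧L
  (∃ w A B, w ∈ T.verts ∧ Fml.and A B ∈ T.ant w ∧ ¬ (A ∈ T.ant w ∧ B ∈ T.ant w) ∧
    updAt T w (insert A (insert B (T.ant w)), T.suc w) T') ∨
  -- ∧R
  (∃ w A B, w ∈ T.verts ∧ Fml.and A B ∈ T.suc w ∧ A ∉ T.suc w ∧ B ∉ T.suc w ∧
    (addSuc T w A T' ∨ addSuc T w B T')) ∨
  -- ⊃L
  (∃ w A B, w ∈ T.verts ∧ Fml.imp A B ∈ T.ant w ∧ A ∉ T.suc w ∧ B ∉ T.ant w ∧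
    (addSuc T w A T' ∨ addAnt T w B T')) ∨
  -- ⟨x⟩L
  (∃ w u x A, w ∈ T.verts ∧ Fml.diaF x A ∈ T.ant w ∧
    (¬ ∃ v, T.Reach ct cb x w v ∧ A ∈ T.ant v) ∧
    extendAt T w u x ({A}, ∅) T') ∨
  -- ⟨x⟩R
  (∃ w u x A, w ∈ T.verts ∧ Fml.diaF x A ∈ T.suc w ∧ T.Reach ct cb x w u ∧
    A ∉ T.suc u ∧ addSuc T u A T') ∨
  -- [x]L
  (∃ w u x A, w ∈ T.verts ∧ Fml.boxF x A ∈ T.ant w ∧ T.Reach ct cb x w u ∧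
    A ∉ T.ant u ∧ addAnt T u A T') ∨
  -- d
  (cd = true ∧ ∃ w u k, T.AtDepth w k ∧ k ≤ m ∧
    (¬ ∃ v, (w, v) ∈ T.edges ∧ T.elabel w v = true) ∧ extendAt T w u true (∅, ∅) T') ∨
  -- db (simultaneous ⊃R / [x]R applications on saturated sequents)
  (Saturated ct cb cd m T ∧
    ((∃ w A B, ImpRRule T w A B T') ∨ (∃ w u x A, BoxRRule T w u x A T')))

/-- `T` occurs in the computation tree `ct(I)` generated by `Prove_C(I)`:
it is obtainable from `I` by a sequence of proof-search steps. -/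
def InCT (ct cb cd : Bool) (I T : SeqTree) : Prop :=
  Relation.ReflTransGen (AlgStep ct cb cd I.mdep) I T

/-! ## Computation trees -/

/-- A node of a computation tree: a seq-tree, the Boolean value returned by the
corresponding recursive call of `Prove_C`, and the list of child nodes. -/
inductive RTree : Type where
  | node : SeqTree → Bool → List RTree → RTree

/-- The seq-tree at the root of a computation tree. -/
def RTree.seq : RTree → SeqTree
  | .node T _ _ => T

/-- The Boolean label at the root of a computation tree. -/
def RTree.val : RTree → Bool
  | .node _ b _ => b

/-- The children of the root of a computation tree. -/
def RTree.kids : RTree → List RTree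
  | .node _ _ ts => ts

/-- Proof search is still running at `T` (none of the halting conditions of
lines 1–6 of `Prove_C` applies). -/
def Running (ct cb cd : Bool) (m : ℕ) (hist : List SeqTree) (T : SeqTree) : Prop :=
  ¬ InitialSeq T ∧ ¬ StableSeq ct cb cd m T ∧ ¬ Repeats ct cb cd m hist T

/-- `ValidCT ct cb cd m hist t`: the labelled tree `t` is a computation tree
generated by a run of `Prove_C` (with ancestor list `hist`): each parent is the
conclusion of a rule of `(NIK_tC ∖ {⊃R, [x]R}) ∪ {db}` with its children the
premises, halting nodes are labelled as the algorithm prescribes, conjunctive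
branching takes the conjunction of the children's values, and the disjunctive
branching rule `db` (applied to saturated sequents, with one premise for each
output implication and each output box) takes their disjunction. -/
inductive ValidCT (ct cb cd : Bool) (m : ℕ) : List SeqTree → RTree → Prop where
  | initial {hist T} : InitialSeq T → ValidCT ct cb cd m hist (.node T true [])
  | stable {hist T} : ¬ InitialSeq T → StableSeq ct cb cd m T →
      ValidCT ct cb cd m hist (.node T false [])
  | rep {hist T} : ¬ InitialSeq T → Repeats ct cb cd m hist T →
      ValidCT ct cb cd m hist (.node T false [])
  | orL {hist T w A B t1 t2} : Running ct cb cd m hist T →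
      w ∈ T.verts → Fml.or A B ∈ T.ant w → A ∉ T.ant w → B ∉ T.ant w →
      addAnt T w A t1.seq → addAnt T w B t2.seq →
      ValidCT ct cb cd m (T :: hist) t1 → ValidCT ct cb cd m (T :: hist) t2 →
      ValidCT ct cb cd m hist (.node T (t1.val && t2.val) [t1, t2])
  | orR {hist T w A B t} : Running ct cb cd m hist T →
      w ∈ T.verts → Fml.or A B ∈ T.suc w → ¬ (A ∈ T.suc w ∧ B ∈ T.suc w) →
      updAt T w (T.ant w, insert A (insert B (T.suc w))) t.seq →
      ValidCT ct cb cd m (T :: hist) t →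
      ValidCT ct cb cd m hist (.node T t.val [t])
  | andL {hist T w A B t} : Running ct cb cd m hist T →
      w ∈ T.verts → Fml.and A B ∈ T.ant w → ¬ (A ∈ T.ant w ∧ B ∈ T.ant w) →
      updAt T w (insert A (insert B (T.ant w)), T.suc w) t.seq →
      ValidCT ct cb cd m (T :: hist) t →
      ValidCT ct cb cd m hist (.node T t.val [t])
  | andR {hist T w A B t1 t2} : Running ct cb cd m hist T →
      w ∈ T.verts → Fml.and A B ∈ T.suc w → A ∉ T.suc w → B ∉ T.suc w →
      addSuc T w A t1.seq → addSuc T w B t2.seq →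
      ValidCT ct cb cd m (T :: hist) t1 → ValidCT ct cb cd m (T :: hist) t2 →
      ValidCT ct cb cd m hist (.node T (t1.val && t2.val) [t1, t2])
  | impL {hist T w A B t1 t2} : Running ct cb cd m hist T →
      w ∈ T.verts → Fml.imp A B ∈ T.ant w → A ∉ T.suc w → B ∉ T.ant w →
      addSuc T w A t1.seq → addAnt T w B t2.seq →
      ValidCT ct cb cd m (T :: hist) t1 → ValidCT ct cb cd m (T :: hist) t2 →
      ValidCT ct cb cd m hist (.node T (t1.val && t2.val) [t1, t2])
  | diaL {hist T w u x A t} : Running ct cb cd m hist T →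
      w ∈ T.verts → Fml.diaF x A ∈ T.ant w →
      (¬ ∃ v, T.Reach ct cb x w v ∧ A ∈ T.ant v) →
      extendAt T w u x ({A}, ∅) t.seq →
      ValidCT ct cb cd m (T :: hist) t →
      ValidCT ct cb cd m hist (.node T t.val [t])
  | diaR {hist T w u x A t} : Running ct cb cd m hist T →
      w ∈ T.verts → Fml.diaF x A ∈ T.suc w → T.Reach ct cb x w u → A ∉ T.suc u →
      addSuc T u A t.seq →
      ValidCT ct cb cd m (T :: hist) t →
      ValidCT ct cb cd m hist (.node T t.val [t])
  | boxL {hist T w u x A t} : Running ct cb cd m hist T →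
      w ∈ T.verts → Fml.boxF x A ∈ T.ant w → T.Reach ct cb x w u → A ∉ T.ant u →
      addAnt T u A t.seq →
      ValidCT ct cb cd m (T :: hist) t →
      ValidCT ct cb cd m hist (.node T t.val [t])
  | d {hist T w u k t} : Running ct cb cd m hist T →
      cd = true → T.AtDepth w k → k ≤ m →
      (¬ ∃ v, (w, v) ∈ T.edges ∧ T.elabel w v = true) →
      extendAt T w u true (∅, ∅) t.seq →
      ValidCT ct cb cd m (T :: hist) t →
      ValidCT ct cb cd m hist (.node T t.val [t])
  | db {hist T ts} : Running ct cb cd m hist T →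
      Saturated ct cb cd m T →
      (∀ t ∈ ts, ValidCT ct cb cd m (T :: hist) t) →
      (∀ t ∈ ts, (∃ w A B, ImpRRule T w A B t.seq) ∨ (∃ w u x A, BoxRRule T w u x A t.seq)) →
      (∀ w ∈ T.verts, ∀ A B, Fml.imp A B ∈ T.suc w → ∃ t ∈ ts, ImpRRule T w A B t.seq) →
      (∀ w ∈ T.verts, ∀ x A, Fml.boxF x A ∈ T.suc w → ∃ t ∈ ts, ∃ u, BoxRRule T w u x A t.seq) →
      ValidCT ct cb cd m hist (.node T (ts.any RTree.val) ts)

/-! ## Blueprints and the extracted counter-model -/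

/-- The subtree of a computation tree at the address `π` (a list of child
positions); addresses play the role of the positions of the enumeration `η`. -/
def RTree.at? : RTree → List ℕ → Option RTree
  | t, [] => some t
  | t, i :: π =>
    match t.kids[i]? with
    | some t' => t'.at? π
    | none => none

/-- The seq-tree at the address `π` of a computation tree. -/
def RTree.seqAt (t : RTree) (π : List ℕ) : SeqTree :=
  (t.at? π).elim default RTree.seq

/-- The node at address `π` exists and every node on the path from the root to
it (inclusive) is labelled `F`; these are the nodes of the blueprint `bp(I)`. -/
def FNode (t : RTree) (π : List ℕ) : Prop :=
  ∀ σ, σ <+: π → ∃ s, t.at? σ = some s ∧ s.val = false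

/-- Membership in the set `S` of the blueprint: an `F`-reachable node whose
seq-tree is `C`-saturated (an η-renamed saturated seq-tree of `bp(I)`;
the vertex `w` of the seq-tree at address `π` represents the renamed
component `(w, π)`). -/
def InSsat (ct cb cd : Bool) (m : ℕ) (t : RTree) (π : List ℕ) : Prop :=
  FNode t π ∧ Saturated ct cb cd m (t.seqAt π)

/-- The node at address `π` is a repeat of the blueprint: an `F`-path leaf of
the computation tree that is saturated but not stable. -/
def RepNode (ct cb cd : Bool) (m : ℕ) (t : RTree) (π : List ℕ) : Prop :=
  FNode t π ∧ (∃ s, t.at? π = some s ∧ s.kids = []) ∧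
  Saturated ct cb cd m (t.seqAt π) ∧ ¬ StableSeq ct cb cd m (t.seqAt π)

/-- `(gc, gf)` is a family `γ⃗` of strong morphisms mapping each repeat of the
blueprint to its companion: a proper ancestor belonging to `S` (C-saturated,
on an `F`-path) together with a strong morphism onto it. -/
def GammaOK (ct cb cd : Bool) (m : ℕ) (t : RTree)
    (gc : List ℕ → List ℕ) (gf : List ℕ → ℕ → ℕ) : Prop :=
  ∀ π, RepNode ct cb cd m t π →
    gc π <+: π ∧ gc π ≠ π ∧ InSsat ct cb cd m t (gc π) ∧
    StrongMorphism (t.seqAt π) (t.seqAt (gc π)) (gf π)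

/-- One step of a morphic sequence: either a natural morphism between members
of `S` related by `≺_bp*` (mapping `(w, π)` to `(w, π')`), or a strong morphism
of the family `γ⃗` mapping a repeat to its companion. -/
inductive MStep (ct cb cd : Bool) (m : ℕ) (t : RTree)
    (gc : List ℕ → List ℕ) (gf : List ℕ → ℕ → ℕ) :
    (ℕ × List ℕ) → (ℕ × List ℕ) → Prop where
  | nat {w : ℕ} {π π' : List ℕ} :
      InSsat ct cb cd m t π → InSsat ct cb cd m t π' → π <+: π' →
      w ∈ (t.seqAt π).verts →
      MStep ct cb cd m t gc gf (w, π) (w, π')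
  | rep {w : ℕ} {π : List ℕ} :
      RepNode ct cb cd m t π → w ∈ (t.seqAt π).verts →
      MStep ct cb cd m t gc gf (w, π) (gf π w, gc π)

/-- A morphic sequence `(w, π) ⟶_σ (u, π')` in the blueprint. -/
def MSeq (ct cb cd : Bool) (m : ℕ) (t : RTree)
    (gc : List ℕ → List ℕ) (gf : List ℕ → ℕ → ℕ) :
    (ℕ × List ℕ) → (ℕ × List ℕ) → Prop :=
  Relation.ReflTransGen (MStep ct cb cd m t gc gf)

/-- The set `W` of worlds of the extracted model: the (renamed) components of
the saturated seq-trees of the blueprint. -/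
def Worlds (ct cb cd : Bool) (m : ℕ) (t : RTree) : Set (ℕ × List ℕ) :=
  {a | InSsat ct cb cd m t a.2 ∧ a.1 ∈ (t.seqAt a.2).verts}

/-- The modal relation `R` of the extracted model: induced by the C-closure
reachability relation inside each saturated seq-tree, together with self-loops
at components of depth `m + 1` when `D ∈ C`. -/
def bpR (ct cb cd : Bool) (m : ℕ) (t : RTree) :
    (ℕ × List ℕ) → (ℕ × List ℕ) → Prop :=
  fun a b =>
    (a.2 = b.2 ∧ InSsat ct cb cd m t a.2 ∧ (t.seqAt a.2).Reach ct cb true a.1 b.1) ∨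
    (cd = true ∧ a = b ∧ InSsat ct cb cd m t a.2 ∧ (t.seqAt a.2).AtDepth a.1 (m + 1))

/-- The valuation `V` of the extracted model: `(w, π) ∈ V(p)` iff `p` occurs in
the antecedent of the component `(w, π)`. -/
def bpVal (ct cb cd : Bool) (m : ℕ) (t : RTree) : (ℕ × List ℕ) → ℕ → Prop :=
  fun a p => InSsat ct cb cd m t a.2 ∧ Fml.atom p ∈ (t.seqAt a.2).ant a.1

/-- Satisfaction over raw frame data (the same clauses as `Model.Sat`). -/
def SatR {W : Type} (le R : W → W → Prop) (val : W → ℕ → Prop) : W → Fml → Prop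
  | w, .atom p => val w p
  | _, .bot => False
  | w, .or A B => SatR le R val w A ∨ SatR le R val w B
  | w, .and A B => SatR le R val w A ∧ SatR le R val w B
  | w, .imp A B => ∀ u, le w u → SatR le R val u A → SatR le R val u B
  | w, .dia A => ∃ u, R w u ∧ SatR le R val u A
  | w, .bdia A => ∃ u, R u w ∧ SatR le R val u A
  | w, .box A => ∀ u v, le w u → R u v → SatR le R val v A
  | w, .bbox A => ∀ u v, le w u → R v u → SatR le R val v A

namespace Fml

@[simp] lemma mdep_diaF (x : Bool) (A : Fml) : (diaF x A).mdep = A.mdep + 1 := by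
  cases x <;> rfl

@[simp] lemma mdep_boxF (x : Bool) (A : Fml) : (boxF x A).mdep = A.mdep + 1 := by
  cases x <;> rfl

end Fml

namespace SeqTree

variable {T T' : SeqTree} {ct cb cd x : Bool} {m k l u v w : ℕ}

/-- Every formula in a component at depth `k` has modal depth at most `m - k`. -/
def DepthBounded (m : ℕ) (T : SeqTree) : Prop :=
  ∀ w ∈ T.verts, ∀ k, T.AtDepth w k → ∀ B ∈ T.ant w ∪ T.suc w, B.mdep + k ≤ m

lemma AtDepth.exists_of_edge (h : T.AtDepth u k) (e : (w, u) ∈ T.edges) :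
    ∃ l, T.AtDepth w l ∧ k = l + 1 := by
  cases h with
  | root => exact absurd e (T.root_no_parent w)
  | step h' e' =>
    have := T.parent_unique u (T.edges_sub _ e).2 _ _ e e'
    subst this
    exact ⟨_, h', rfl⟩

lemma AtDepth.unique (h : T.AtDepth u k) (h' : T.AtDepth u l) : k = l := by
  induction h generalizing l with
  | root =>
    cases h' with
    | root => rfl
    | step _ e => exact absurd e (T.root_no_parent _)
  | step _ e ih =>
    obtain ⟨j, hj, rfl⟩ := h'.exists_of_edge e
    rw [ih hj]

lemma Reach.atDepth_le (h : T.Reach ct cb x w u) (hu : T.AtDepth u k) :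
    ∃ l, T.AtDepth w l ∧ k ≤ l + 1 := by
  have down (e : (w, u) ∈ T.edges) : ∃ l, T.AtDepth w l ∧ k ≤ l + 1 := by
    obtain ⟨l, hl, rfl⟩ := hu.exists_of_edge e
    exact ⟨l, hl, le_rfl⟩
  have up (e : (u, w) ∈ T.edges) : ∃ l, T.AtDepth w l ∧ k ≤ l + 1 :=
    ⟨k + 1, hu.step e, by omega⟩
  rcases h with ⟨e, _⟩ | ⟨e, _⟩ | ⟨_, rfl, _⟩ | ⟨_, ⟨e, _⟩ | ⟨e, _⟩⟩
  · exact down e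
  · exact up e
  · exact ⟨k, hu, by omega⟩
  · exact down e
  · exact up e

lemma depthBounded_mdep (T : SeqTree) : T.DepthBounded T.mdep := by
  intro w hw k hk B hB
  refine le_csSup (Set.Finite.bddAbove ?_) ⟨w, hw, k, hk, B, hB, rfl⟩
  have hfin : (⋃ w ∈ T.verts, ⋃ A ∈ T.ant w ∪ T.suc w,
      {n | ∃ k, T.AtDepth w k ∧ n = A.mdep + k}).Finite := by
    refine T.verts.finite_toSet.biUnion fun w _ => Finset.finite_toSet _ |>.biUnion fun A _ => ?_
    refine Set.Subsingleton.finite ?_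
    rintro _ ⟨k, hk, rfl⟩ _ ⟨l, hl, rfl⟩
    rw [hk.unique hl]
  refine hfin.subset ?_
  rintro n ⟨w, hw, k, hk, A, hA, rfl⟩
  simp only [Set.mem_iUnion]
  exact ⟨w, hw, A, hA, k, hk, rfl⟩

lemma AtDepth.of_sameShape (hs : sameShape T T') (h : T'.AtDepth w k) : T.AtDepth w k := by
  obtain ⟨-, hr, he, -⟩ := hs
  induction h with
  | root => rw [hr]; exact .root
  | step _ e ih => exact ih.step (he ▸ e)

lemma DepthBounded.of_updAt {s : GSeq} (hT : T.DepthBounded m)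
    (hs : ∀ k, T.AtDepth w k → ∀ B ∈ s.1 ∪ s.2, B.mdep + k ≤ m) (hu : updAt T w s T') :
    T'.DepthBounded m := by
  intro v hv k hk B hB
  have hk' := hk.of_sameShape hu.1
  rw [ant, suc, hu.2] at hB
  by_cases hvw : v = w
  · subst hvw
    rw [Function.update_self] at hB
    exact hs k hk' B hB
  · rw [Function.update_of_ne hvw] at hB
    exact hT v (hu.1.1 ▸ hv) k hk' B hB

lemma DepthBounded.of_addAnt {A : Fml} (hT : T.DepthBounded m)
    (hA : ∀ k, T.AtDepth w k → A.mdep + k ≤ m) (h : addAnt T w A T') : T'.DepthBounded m := by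
  refine hT.of_updAt (fun k hk B hB => ?_) h.2
  rw [Finset.insert_union, Finset.mem_insert] at hB
  rcases hB with rfl | hB
  · exact hA k hk
  · exact hT w h.1 k hk B hB

lemma DepthBounded.of_addSuc {A : Fml} (hT : T.DepthBounded m)
    (hA : ∀ k, T.AtDepth w k → A.mdep + k ≤ m) (h : addSuc T w A T') : T'.DepthBounded m := by
  refine hT.of_updAt (fun k hk B hB => ?_) h.2
  rw [Finset.union_insert, Finset.mem_insert] at hB
  rcases hB with rfl | hB
  · exact hA k hk
  · exact hT w h.1 k hk B hB

lemma AtDepth.of_insert_edge (hu : u ∉ T.verts) (hr : T'.root = T.root)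
    (he : T'.edges = insert (w, u) T.edges) (h : T'.AtDepth v k) (hv : v ∈ T.verts) :
    T.AtDepth v k := by
  induction h with
  | root => rw [hr]; exact .root
  | step _ e ih =>
    rw [he, Finset.mem_insert] at e
    rcases e with e | e
    · cases e
      exact absurd hv hu
    · exact (ih (T.edges_sub _ e).1).step e

lemma DepthBounded.of_insert_child (hT : T.DepthBounded m) (hw : w ∈ T.verts) (hu : u ∉ T.verts)
    (hV : T'.verts = insert u T.verts) (hr : T'.root = T.root)
    (he : T'.edges = insert (w, u) T.edges)
    (hold : ∀ v ∈ T.verts, T'.ant v ∪ T'.suc v ⊆ T.ant v ∪ T.suc v)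
    (hnew : ∀ k, T.AtDepth w k → ∀ B ∈ T'.ant u ∪ T'.suc u, B.mdep + (k + 1) ≤ m) :
    T'.DepthBounded m := by
  intro v hv k hk B hB
  rw [hV, Finset.mem_insert] at hv
  rcases hv with rfl | hv
  · obtain ⟨l, hl, rfl⟩ := hk.exists_of_edge (w := w) (he ▸ Finset.mem_insert_self _ _)
    exact hnew l (hl.of_insert_edge hu hr he hw) B hB
  · exact hT v hv k (hk.of_insert_edge hu hr he hv) B (hold v hv hB)

lemma DepthBounded.of_extendAt {s : GSeq} (hT : T.DepthBounded m)
    (hs : ∀ k, T.AtDepth w k → ∀ B ∈ s.1 ∪ s.2, B.mdep + (k + 1) ≤ m)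
    (h : extendAt T w u x s T') : T'.DepthBounded m := by
  obtain ⟨hw, hu, hV, hr, he, -, hl⟩ := h
  refine hT.of_insert_child hw hu hV hr he (fun v hv => ?_) (by simpa [ant, suc, hl] using hs)
  have hvu : v ≠ u := fun h => hu (h ▸ hv)
  simp [ant, suc, hl, hvu]

lemma DepthBounded.of_impRRule {A B : Fml} (hT : T.DepthBounded m) (h : ImpRRule T w A B T') :
    T'.DepthBounded m := by
  obtain ⟨hw, hAB, hs, hne, heq⟩ := h
  intro v hv k hk C hC
  have hk' := hk.of_sameShape hs
  rw [hs.1] at hv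
  by_cases hvw : v = w
  · subst hvw
    have hI := hT v hw k hk' _ (Finset.mem_union_right _ hAB)
    simp only [Fml.mdep] at hI
    rw [ant, suc, heq, Finset.insert_union, Finset.mem_insert, Finset.mem_union,
      Finset.mem_singleton] at hC
    rcases hC with rfl | hC | rfl
    · omega
    · exact hT v hw k hk' C (Finset.mem_union_left _ hC)
    · omega
  · rw [ant, suc, hne v hvw, Finset.union_empty] at hC
    exact hT v hv k hk' C (Finset.mem_union_left _ hC)

lemma DepthBounded.of_boxRRule {A : Fml} (hT : T.DepthBounded m) (h : BoxRRule T w u x A T') :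
    T'.DepthBounded m := by
  obtain ⟨hw, hu, hA, hV, hr, he, -, hold, hnew⟩ := h
  refine hT.of_insert_child hw hu hV hr he (fun v hv => ?_) (fun k hk B hB => ?_)
  · rw [ant, suc, hold v hv, Finset.union_empty]
    exact Finset.subset_union_left
  · have hb := hT w hw k hk _ (Finset.mem_union_right _ hA)
    rw [Fml.mdep_boxF] at hb
    rw [ant, suc, hnew, Finset.empty_union, Finset.mem_singleton] at hB
    subst hB
    omega

lemma DepthBounded.algStep (hT : T.DepthBounded m) (h : AlgStep ct cb cd m T T') :
    T'.DepthBounded m := by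
  have hL {w k : ℕ} {A : Fml} (hw : w ∈ T.verts) (hk : T.AtDepth w k) (hA : A ∈ T.ant w) :
      A.mdep + k ≤ m := hT w hw k hk A (Finset.mem_union_left _ hA)
  have hR {w k : ℕ} {A : Fml} (hw : w ∈ T.verts) (hk : T.AtDepth w k) (hA : A ∈ T.suc w) :
      A.mdep + k ≤ m := hT w hw k hk A (Finset.mem_union_right _ hA)
  rcases h with ⟨w, A, B, hw, hF, -, -, h⟩ | ⟨w, A, B, hw, hF, -, h⟩ | ⟨w, A, B, hw, hF, -, h⟩ |
    ⟨w, A, B, hw, hF, -, -, h⟩ | ⟨w, A, B, hw, hF, -, -, h⟩ | ⟨w, u, x, A, hw, hF, -, h⟩ |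
    ⟨w, u, x, A, hw, hF, hr, -, h⟩ | ⟨w, u, x, A, hw, hF, hr, -, h⟩ | ⟨-, w, u, k, -, -, -, h⟩ |
    ⟨-, ⟨w, A, B, h⟩ | ⟨w, u, x, A, h⟩⟩
  · rcases h with h | h <;>
    · refine hT.of_addAnt (fun k hk => ?_) h
      have := hL hw hk hF
      simp only [Fml.mdep] at this
      omega
  · refine hT.of_updAt (fun k hk C hC => ?_) h
    have := hR hw hk hF
    simp only [Fml.mdep] at this
    simp only [Finset.mem_union, Finset.mem_insert] at hC
    rcases hC with hC | rfl | rfl | hC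
    · exact hL hw hk hC
    · omega
    · omega
    · exact hR hw hk hC
  · refine hT.of_updAt (fun k hk C hC => ?_) h
    have := hL hw hk hF
    simp only [Fml.mdep] at this
    simp only [Finset.mem_union, Finset.mem_insert] at hC
    rcases hC with (rfl | rfl | hC) | hC
    · omega
    · omega
    · exact hL hw hk hC
    · exact hR hw hk hC
  · rcases h with h | h <;>
    · refine hT.of_addSuc (fun k hk => ?_) h
      have := hR hw hk hF
      simp only [Fml.mdep] at this
      omega
  · rcases h with h | h
    · refine hT.of_addSuc (fun k hk => ?_) h
      have := hL hw hk hF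
      simp only [Fml.mdep] at this
      omega
    · refine hT.of_addAnt (fun k hk => ?_) h
      have := hL hw hk hF
      simp only [Fml.mdep] at this
      omega
  · refine hT.of_extendAt (fun k hk B hB => ?_) h
    have := hL hw hk hF
    rw [Fml.mdep_diaF] at this
    rw [Finset.union_empty, Finset.mem_singleton] at hB
    subst hB
    omega
  · refine hT.of_addSuc (fun k hk => ?_) h
    obtain ⟨l, hl, hkl⟩ := hr.atDepth_le hk
    have := hR hw hl hF
    rw [Fml.mdep_diaF] at this
    omega
  · refine hT.of_addAnt (fun k hk => ?_) h
    obtain ⟨l, hl, hkl⟩ := hr.atDepth_le hk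
    have := hL hw hl hF
    rw [Fml.mdep_boxF] at this
    omega
  · exact hT.of_extendAt (by simp) h
  · exact hT.of_impRRule h
  · exact hT.of_boxRRule h

end SeqTree

lemma InCT.depthBounded {ct cb cd : Bool} {I G : SeqTree} (h : InCT ct cb cd I G) :
    G.DepthBounded I.mdep := by
  induction h with
  | refl => exact I.depthBounded_mdep
  | tail _ hstep ih => exact ih.algStep hstep

/-- Lemma 4.5(1), depth bound: for every nested sequent `G`
occurring in the computation tree `ct(I)`, every component `w` of `G` at depth
`k`, and every formula `B` occurring at `w`, `md(B) ≤ md(I) − k`. -/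
theorem depth_bound (ct cb cd : Bool) (I G : SeqTree) (h : InCT ct cb cd I G)
    (w k : ℕ) (hw : w ∈ G.verts) (hk : G.AtDepth w k)
    (B : Fml) (hB : B ∈ G.ant w ∪ G.suc w) :
    (B.mdep : ℤ) ≤ (I.mdep : ℤ) - (k : ℤ) := by
  have := h.depthBounded w hw k hk B hB
  omega
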